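/- For every i ∈ {1,…,6} and all a,b,c ∈ ℤ, one has ηᵢ(vS₀(a,b,c)) = ηᵢ(vS₁(a,b,c)) = ηᵢ(vS₂(a,b,c)) = ηᵢ(vS₃(a,b,c)) = 0. -/

import Mathlib

noncomputable section

abbrev Xsp : Type := (ℤ × ℤ) →₀ ℚ
abbrev Ysp : Type := ℤ →₀ ℚ
abbrev V : Type := Xsp × Ysp

/-- The basis vector `X_{a,b}` of `V`. -/
def XB (a b : ℤ) : V := (Finsupp.single (a, b) 1, 0)

/-- The basis vector `Y_d` of `V`. -/
def YB (d : ℤ) : V := (0, Finsupp.single d 1)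

/-- The linear map `V → ℚ` determined on the basis by `X_{a,b} ↦ gX (a,b)`, `Y_d ↦ gY d`. -/
def lmap (gX : ℤ × ℤ → ℚ) (gY : ℤ → ℚ) : V →ₗ[ℚ] ℚ :=
  (Finsupp.linearCombination ℚ gX).comp (LinearMap.fst ℚ Xsp Ysp)
  + (Finsupp.linearCombination ℚ gY).comp (LinearMap.snd ℚ Xsp Ysp)

/-- `η₁ : X_{a,b} ↦ (a+b)²` for `a+b` odd, `Y_d ↦ -d²` for `d` odd, all else to `0`. -/
def eta1 : V →ₗ[ℚ] ℚ :=
  lmap (fun p => if Odd (p.1 + p.2) then ((p.1 : ℚ) + p.2) ^ 2 else 0)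
    (fun d => if Odd d then -(d : ℚ) ^ 2 else 0)

/-- `η₂ : X_{a,b} ↦ (a+b)²` for `a+b` even, `Y_d ↦ -d²` for `d` even, all else to `0`. -/
def eta2 : V →ₗ[ℚ] ℚ :=
  lmap (fun p => if Even (p.1 + p.2) then ((p.1 : ℚ) + p.2) ^ 2 else 0)
    (fun d => if Even d then -(d : ℚ) ^ 2 else 0)

/-- `η₃ : X_{a,b} ↦ 1` for `a` even, `b` odd, all else to `0`. -/
def eta3 : V →ₗ[ℚ] ℚ :=
  lmap (fun p => if Even p.1 ∧ Odd p.2 then 1 else 0) (fun _ => 0)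

/-- `η₄ : X_{a,b} ↦ 1` for `a` even, `b` even, all else to `0`. -/
def eta4 : V →ₗ[ℚ] ℚ :=
  lmap (fun p => if Even p.1 ∧ Even p.2 then 1 else 0) (fun _ => 0)

/-- `η₅ : X_{a,b} ↦ 1` for `a` odd, `b` even, all else to `0`. -/
def eta5 : V →ₗ[ℚ] ℚ :=
  lmap (fun p => if Odd p.1 ∧ Even p.2 then 1 else 0) (fun _ => 0)

/-- `η₆ : X_{a,b} ↦ 1` for `a` odd, `b` odd, all else to `0`. -/
def eta6 : V →ₗ[ℚ] ℚ :=
  lmap (fun p => if Odd p.1 ∧ Odd p.2 then 1 else 0) (fun _ => 0)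

/-- The six linear maps `η₁, …, η₆`. -/
def eta : Fin 6 → (V →ₗ[ℚ] ℚ) := ![eta1, eta2, eta3, eta4, eta5, eta6]

/-- The value `F⁽¹⁾(S_{a,b,c})`. -/
def vS0 (a b c : ℤ) : V :=
  -XB a (b + c + 2) - XB b (c + a + 2) - XB c (a + b + 2)
    + XB a (b + c) + XB b (c + a) + XB c (a + b)
    - YB (a + b + c + 4) + YB (a + b + c - 2)

/-- The value `F⁽¹⁾(S_{â,b,c})`. -/
def vS1 (a b c : ℤ) : V :=
  -XB c (a + b + 1) - XB (b + c - 1) a - XB b (c + a + 1)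
    + XB (b + c + 1) a + XB b (c + a - 1) + XB c (a + b - 1)
    - YB (a + b + c + 1) + YB (a + b + c - 1)

/-- The value `F⁽¹⁾(S_{â,b̂,c})`. -/
def vS2 (a b c : ℤ) : V :=
  -XB c (a + b + 1) - XB (c + a - 1) b - XB (b + c - 1) a
    + XB (b + c + 1) a + XB c (a + b - 1) + XB (c + a + 1) b
    - YB (a + b + c - 1) + YB (a + b + c + 1)

/-- The value `F⁽¹⁾(S_{â,b̂,ĉ})`. -/
def vS3 (a b c : ℤ) : V :=
  -XB (b + c - 2) a - XB (c + a - 2) b - XB (a + b - 2) c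
    + XB (a + b) c + XB (b + c) a + XB (c + a) b
    - YB (a + b + c - 4) + YB (a + b + c + 2)

@[simp]
theorem lmap_XB (gX : ℤ × ℤ → ℚ) (gY : ℤ → ℚ) (a b : ℤ) : lmap gX gY (XB a b) = gX (a, b) := by
  simp [lmap, XB]

@[simp]
theorem lmap_YB (gX : ℤ × ℤ → ℚ) (gY : ℤ → ℚ) (d : ℤ) : lmap gX gY (YB d) = gY d := by
  simp [lmap, YB]

theorem eta_vS0 (i : Fin 6) (a b c : ℤ) : eta i (vS0 a b c) = 0 := by
  fin_cases i <;> by_cases ha : Even a <;> by_cases hb : Even b <;> by_cases hc : Even c <;>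
    simp [eta, eta1, eta2, eta3, eta4, eta5, eta6, vS0, ← Int.not_even_iff_odd,
      Int.even_add, ha, hb, hc, show Even (4 : ℤ) by decide] <;>
    ring

theorem eta_vS1 (i : Fin 6) (a b c : ℤ) : eta i (vS1 a b c) = 0 := by
  fin_cases i <;> by_cases ha : Even a <;> by_cases hb : Even b <;> by_cases hc : Even c <;>
    simp [eta, eta1, eta2, eta3, eta4, eta5, eta6, vS1, ← Int.not_even_iff_odd,
      Int.even_add, ha, hb, hc] <;>
    ring

theorem eta_vS2 (i : Fin 6) (a b c : ℤ) : eta i (vS2 a b c) = 0 := by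
  fin_cases i <;> by_cases ha : Even a <;> by_cases hb : Even b <;> by_cases hc : Even c <;>
    simp [eta, eta1, eta2, eta3, eta4, eta5, eta6, vS2, ← Int.not_even_iff_odd,
      Int.even_add, ha, hb, hc] <;>
    ring

theorem eta_vS3 (i : Fin 6) (a b c : ℤ) : eta i (vS3 a b c) = 0 := by
  fin_cases i <;> by_cases ha : Even a <;> by_cases hb : Even b <;> by_cases hc : Even c <;>
    simp [eta, eta1, eta2, eta3, eta4, eta5, eta6, vS3, ← Int.not_even_iff_odd,
      Int.even_add, Int.even_sub, ha, hb, hc, show Even (4 : ℤ) by decide] <;>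
    ring

theorem stmt14 : ∀ i : Fin 6, ∀ a b c : ℤ,
    eta i (vS0 a b c) = 0 ∧ eta i (vS1 a b c) = 0 ∧
    eta i (vS2 a b c) = 0 ∧ eta i (vS3 a b c) = 0 :=
  fun i a b c => ⟨eta_vS0 i a b c, eta_vS1 i a b c, eta_vS2 i a b c, eta_vS3 i a b c⟩
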